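/- Let 0 < ℓ ≤ L with κ = L/ℓ > 1, let η > 0, and let s and h be the ESGD parameters. Let A ∈ ℝ^{d×d} be symmetric with all eigenvalues in [ℓ, L]. Then the operator 2-norm of B_s(−hA) satisfies ‖B_s(−hA)‖ ≤ 1. -/

import Mathlib

open Polynomial Matrix

noncomputable section

/-- The degree-`n` Chebyshev polynomial of the first kind over `ℝ`,
characterized by `T_n (cos θ) = cos (n θ)`. -/
def chebT (n : ℕ) : Polynomial ℝ := Polynomial.Chebyshev.T ℝ (n : ℤ)

/-- `ω₀ = 1 + η / s²`. -/
def omega0 (s : ℕ) (η : ℝ) : ℝ := 1 + η / (s : ℝ) ^ 2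

/-- `ω₁ = T_s(ω₀) / T_s'(ω₀)`. -/
def omega1 (s : ℕ) (η : ℝ) : ℝ :=
  (chebT s).eval (omega0 s η) / (Polynomial.derivative (chebT s)).eval (omega0 s η)

/-- `α_s(η) = 1 / T_s(ω₀)`. -/
def alphaS (s : ℕ) (η : ℝ) : ℝ := ((chebT s).eval (omega0 s η))⁻¹

/-- The stability polynomial `R_s(z) = T_s(ω₀ + ω₁ z) / T_s(ω₀)`. -/
def RsPoly (s : ℕ) (η : ℝ) : Polynomial ℝ :=
  Polynomial.C (alphaS s η) *
    (chebT s).comp (Polynomial.C (omega0 s η) + Polynomial.C (omega1 s η) * Polynomial.X)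

/-- The polynomial `B_s` with `ζ · B_s(ζ) = R_s(ζ) − 1`. -/
def BsPoly (s : ℕ) (η : ℝ) : Polynomial ℝ := (RsPoly s η - 1) /ₘ Polynomial.X

/-- The ESGD stage number `s = ⌈√((κ−1)η/2)⌉`. -/
def stages (κ η : ℝ) : ℕ := ⌈Real.sqrt ((κ - 1) * η / 2)⌉₊

/-- The ESGD step size `h = (ω₀ − 1)/(ω₁ ℓ)`. -/
def stepSize (κ η ℓ : ℝ) : ℝ :=
  (omega0 (stages κ η) η - 1) / (omega1 (stages κ η) η * ℓ)

/-- The constant `C(η) = ω₁ α_s(η) / (ω₀ − 1)`. -/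
def Ceta (s : ℕ) (η : ℝ) : ℝ := omega1 s η * alphaS s η / (omega0 s η - 1)

end

open Polynomial.Chebyshev in
lemma aux_T_abs_le (n : ℤ) {x y : ℝ} (hx : -1 ≤ x) (hxy : x ≤ y) (hy : 1 ≤ y) :
    |(T ℝ n).eval x| ≤ (T ℝ n).eval y := by
  rcases le_total x 1 with h | h
  · exact (abs_eval_T_real_le_one n (abs_le.2 ⟨hx, h⟩)).trans (one_le_eval_T_real n hy)
  · rw [abs_of_nonneg (zero_le_one.trans (one_le_eval_T_real n h))]
    have h1 := Real.cosh_arcosh h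
    have h2 := Real.cosh_arcosh hy
    have h3 : Real.arcosh x ≤ Real.arcosh y := by
      have h4 : Real.cosh (Real.arcosh x) ≤ Real.cosh (Real.arcosh y) := by rw [h1, h2]; exact hxy
      rw [Real.cosh_le_cosh, abs_of_nonneg (Real.arcosh_nonneg h),
        abs_of_nonneg (Real.arcosh_nonneg hy)] at h4
      exact h4
    rw [← h1, ← h2, T_real_cosh, T_real_cosh, Real.cosh_le_cosh, abs_mul, abs_mul,
      abs_of_nonneg (Real.arcosh_nonneg h), abs_of_nonneg (Real.arcosh_nonneg hy)]
    gcongr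

open Polynomial.Chebyshev in
lemma aux_dT_abs_le (n : ℕ) {x y : ℝ} (hx : -1 ≤ x) (hxy : x ≤ y) (hy : 1 ≤ y) :
    |(derivative (T ℝ n)).eval x| ≤ (derivative (T ℝ n)).eval y := by
  have h := T_derivative_mem_span_T (R := ℝ) n
  generalize derivative (T ℝ (n : ℤ)) = p0 at h ⊢
  induction h using Submodule.span_induction with
  | mem p hp =>
    obtain ⟨m, -, rfl⟩ := hp
    exact aux_T_abs_le m hx hxy hy
  | zero => simp
  | add p q _ _ hp hq =>
    simp only [eval_add]
    exact (abs_add_le _ _).trans (add_le_add hp hq)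
  | smul a p _ hp =>
    simp only [nsmul_eq_mul, eval_mul, eval_natCast, abs_mul, Nat.abs_cast]
    gcongr

lemma aux_diff (n : ℕ) {x y : ℝ} (hx : -1 ≤ x) (hxy : x < y) (hy : 1 ≤ y) :
    |(chebT n).eval y - (chebT n).eval x| ≤ (derivative (chebT n)).eval y * (y - x) := by
  obtain ⟨c, hc, hc'⟩ := exists_deriv_eq_slope (fun t => (chebT n).eval t) hxy
    (chebT n).continuous.continuousOn (chebT n).differentiable.differentiableOn
  rw [Polynomial.deriv, eq_div_iff (by linarith)] at hc'
  rw [← hc', abs_mul, abs_of_pos (sub_pos.2 hxy)]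
  have := aux_dT_abs_le n (x := c) (y := y) (by linarith [hc.1]) hc.2.le hy
  exact mul_le_mul_of_nonneg_right this (by linarith)

lemma aux_Bs (s : ℕ) (η z : ℝ) (h0 : (chebT s).eval (omega0 s η) ≠ 0) :
    z * (BsPoly s η).eval z =
      (chebT s).eval (omega0 s η + omega1 s η * z) / (chebT s).eval (omega0 s η) - 1 := by
  have h : (RsPoly s η - 1).IsRoot 0 := by
    simp [RsPoly, alphaS, eval_comp, h0]
  have h2 := mul_divByMonic_eq_iff_isRoot.2 h
  rw [C_0, sub_zero] at h2
  have h3 := congrArg (eval z) h2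
  rw [eval_mul, eval_X] at h3
  rw [BsPoly, h3]
  simp [RsPoly, alphaS, eval_comp]
  field_simp

lemma aux_scalar (ℓ L η : ℝ) (hℓ : 0 < ℓ) (hκ : 1 < L / ℓ) (hη : 0 < η)
    (t : ℝ) (ht : t ∈ Set.Icc ℓ L) :
    |(BsPoly (stages (L / ℓ) η) η).eval (-(stepSize (L / ℓ) η ℓ) * t)| ≤ 1 := by
  have hq : 0 < (L / ℓ - 1) * η / 2 := by
    have := sub_pos.2 hκ
    positivity
  have hs : 0 < stages (L / ℓ) η := Nat.ceil_pos.2 (Real.sqrt_pos.2 hq)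
  have hs2 : (L / ℓ - 1) * η / 2 ≤ (stages (L / ℓ) η : ℝ) ^ 2 := by
    have h1 := Nat.le_ceil (Real.sqrt ((L / ℓ - 1) * η / 2))
    calc _ = (Real.sqrt ((L / ℓ - 1) * η / 2)) ^ 2 := (Real.sq_sqrt hq.le).symm
      _ ≤ _ := pow_le_pow_left₀ (Real.sqrt_nonneg _) h1 2
  unfold stepSize
  generalize stages (L / ℓ) η = s at *
  have hs' : (0 : ℝ) < s := by exact_mod_cast hs
  have hw : 1 < omega0 s η := by
    unfold omega0
    have : 0 < η / (s : ℝ) ^ 2 := by positivity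
    linarith
  have hw2 : (omega0 s η - 1) * (L / ℓ - 1) ≤ 2 := by
    unfold omega0
    rw [add_sub_cancel_left, div_mul_eq_mul_div, div_le_iff₀ (by positivity)]
    linarith
  have hT : 1 < (chebT s).eval (omega0 s η) :=
    Polynomial.Chebyshev.one_lt_eval_T_real (by exact_mod_cast hs.ne') hw
  have hT1 : (chebT s).eval 1 = 1 := Polynomial.Chebyshev.T_eval_one ℝ s
  have hD : 0 < (derivative (chebT s)).eval (omega0 s η) := by
    have := aux_diff s (x := 1) (by norm_num) hw hw.le
    rw [hT1, abs_of_pos (by linarith)] at this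
    by_contra hcon
    nlinarith
  have hw1 : 0 < omega1 s η := div_pos (by linarith) hD
  have hB := aux_Bs s η (-((omega0 s η - 1) / (omega1 s η * ℓ)) * t) (by linarith)
  set b := (BsPoly s η).eval (-((omega0 s η - 1) / (omega1 s η * ℓ)) * t)
  have hx : omega0 s η + omega1 s η * (-((omega0 s η - 1) / (omega1 s η * ℓ)) * t)
      = omega0 s η - (omega0 s η - 1) * (t / ℓ) := by
    field_simp
    ring
  rw [hx] at hB
  set x := omega0 s η - (omega0 s η - 1) * (t / ℓ) with hxdef
  have ht1 : 1 ≤ t / ℓ := (one_le_div hℓ).2 ht.1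
  have ht2 : t / ℓ ≤ L / ℓ := div_le_div_of_nonneg_right ht.2 hℓ.le
  have hx1 : x ≤ 1 := by nlinarith
  have hx2 : -1 ≤ x := by nlinarith
  have hd := aux_diff s hx2 (by linarith : x < omega0 s η) hw.le
  have hz : -((omega0 s η - 1) / (omega1 s η * ℓ)) * t = -(omega0 s η - x) / omega1 s η := by
    rw [hxdef]; field_simp; ring
  rw [hz, omega1] at hB
  have hpos : 0 < omega0 s η - x := by linarith
  have hb : b * ((derivative (chebT s)).eval (omega0 s η) * (omega0 s η - x)) =
      (chebT s).eval (omega0 s η) - (chebT s).eval x := by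
    have h0 : (chebT s).eval (omega0 s η) ≠ 0 := by linarith
    field_simp at hB
    linarith
  rw [← hb, abs_mul, abs_of_pos (mul_pos hD hpos)] at hd
  exact le_of_mul_le_mul_right (by rwa [one_mul]) (mul_pos hD hpos)

open scoped Matrix.Norms.L2Operator in
lemma aux_matrix {d : ℕ} (A : Matrix (Fin d) (Fin d) ℝ) (hA : A.IsHermitian) (p : Polynomial ℝ)
    (h : ∀ t ∈ spectrum ℝ A, |p.eval t| ≤ 1) :
    ‖Matrix.toEuclideanCLM (𝕜 := ℝ) (Polynomial.aeval A p)‖ ≤ 1 := by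
  rw [Matrix.l2_opNorm_toEuclideanCLM]
  have h1 : Polynomial.aeval A p = Unitary.conjStarAlgAut ℝ _ hA.eigenvectorUnitary
      (diagonal (fun i => p.eval (hA.eigenvalues i))) := by
    conv_lhs => rw [hA.spectral_theorem]
    have h2 := Polynomial.aeval_algHom_apply
      ((Unitary.conjStarAlgAut ℝ (Matrix (Fin d) (Fin d) ℝ) hA.eigenvectorUnitary :
        _ ≃⋆ₐ[ℝ] _).toAlgEquiv.toAlgHom.comp (Matrix.diagonalAlgHom ℝ)) hA.eigenvalues p
    rw [Polynomial.aeval_pi_apply] at h2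
    simpa using h2
  rw [h1, Unitary.conjStarAlgAut_apply, ← Unitary.coe_star, CStarRing.norm_mul_coe_unitary,
    CStarRing.norm_coe_unitary_mul, Matrix.l2_opNorm_diagonal,
    pi_norm_le_iff_of_nonneg zero_le_one]
  exact fun i => h _ (hA.eigenvalues_mem_spectrum_real i)

/-- With the ESGD parameters `s`, `h` for `0 < ℓ ≤ L`, `κ = L/ℓ > 1`, `η > 0`, and `A`
symmetric with all eigenvalues in `[ℓ, L]`, the operator 2-norm of `B_s(−hA)` is at most 1. -/
theorem bs_matrix_opNorm_le_one {d : ℕ} (ℓ L η : ℝ) (hℓ : 0 < ℓ) (hℓL : ℓ ≤ L)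
    (hκ : 1 < L / ℓ) (hη : 0 < η)
    (A : Matrix (Fin d) (Fin d) ℝ) (hA : A.IsSymm)
    (hspec : spectrum ℝ A ⊆ Set.Icc ℓ L) :
    ‖Matrix.toEuclideanCLM (𝕜 := ℝ)
        (Polynomial.aeval ((-(stepSize (L / ℓ) η ℓ)) • A)
          (BsPoly (stages (L / ℓ) η) η))‖ ≤ 1 := by
  have hH : A.IsHermitian := by
    rw [Matrix.IsHermitian, Matrix.conjTranspose_eq_transpose_of_trivial]; exact hA
  have h := aux_matrix A hH
    ((BsPoly (stages (L / ℓ) η) η).comp (Polynomial.C (-(stepSize (L / ℓ) η ℓ)) * Polynomial.X))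
    (fun t ht => by
      simpa [Polynomial.eval_comp] using aux_scalar ℓ L η hℓ hκ hη t (hspec ht))
  rw [Polynomial.aeval_comp] at h
  simpa [Algebra.smul_def] using h
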